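/- Let τ1 and τ2 be the substitutions on {a,b} given by τ1(a)=aba, τ1(b)=ab and τ2(a)=aab, τ2(b)=ba. Let φ be the substitution on the alphabet {A,B,C,D} given by φ(A)=AB, φ(B)=ABCA, φ(C)=D, φ(D)=DAAC, and let p1, p2 be the monoid morphisms from words over {A,B,C,D} to words over {a,b} given by p1(A)=a, p1(B)=ba, p1(C)=b, p1(D)=ab and p2(A)=a, p2(B)=ab, p2(C)=b, p2(D)=ba. Then for every n ∈ ℕ, p1(φ^n(A)) = τ1^n(a) and p2(φ^n(A)) = τ2^n(a); that is, φ generates the decomposition of the two fixed points into the balanced blocks (a,a), (ba,ab), (b,b), (ab,ba). -/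

import Mathlib

/- STATEMENT 7: The morphism φ on the balanced-block alphabet {A,B,C,D}
generates the fixed points of τ1 and τ2 via the projections p1, p2. -/

namespace Stmt7

inductive AB : Type
  | a | b
deriving DecidableEq

inductive L : Type
  | A | B | C | D
deriving DecidableEq

/-- Extension of a letter-to-word map to a morphism of free monoids. -/
def subst {α β : Type} (f : α → List β) (w : List α) : List β :=
  w.flatMap f

def τ1 : AB → List AB
  | .a => [.a, .b, .a]
  | .b => [.a, .b]

def τ2 : AB → List AB
  | .a => [.a, .a, .b]
  | .b => [.b, .a]

def φ : L → List L
  | .A => [.A, .B]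
  | .B => [.A, .B, .C, .A]
  | .C => [.D]
  | .D => [.D, .A, .A, .C]

def p1 : L → List AB
  | .A => [.a]
  | .B => [.b, .a]
  | .C => [.b]
  | .D => [.a, .b]

def p2 : L → List AB
  | .A => [.a]
  | .B => [.a, .b]
  | .C => [.b]
  | .D => [.b, .a]

theorem subst_subst {α β γ : Type} (f : α → List β) (g : β → List γ) (w : List α) :
    subst g (subst f w) = subst (fun x => subst g (f x)) w :=
  List.flatMap_assoc

/-- Semiconjugacy of morphisms of free monoids can be checked on letters. -/
theorem semiconj_subst {α β : Type} {p : α → List β} {f : α → List α} {g : β → List β}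
    (h : ∀ x, subst p (f x) = subst g (p x)) :
    Function.Semiconj (subst p) (subst f) (subst g) := fun w => by
  simp only [subst_subst, h]

theorem semiconj_p1 : Function.Semiconj (subst p1) (subst φ) (subst τ1) :=
  semiconj_subst (by rintro (_ | _ | _ | _) <;> rfl)

theorem semiconj_p2 : Function.Semiconj (subst p2) (subst φ) (subst τ2) :=
  semiconj_subst (by rintro (_ | _ | _ | _) <;> rfl)

theorem phi_generates_common_points :
    ∀ n : ℕ,
      subst p1 ((subst φ)^[n] [L.A]) = (subst τ1)^[n] [AB.a] ∧
      subst p2 ((subst φ)^[n] [L.A]) = (subst τ2)^[n] [AB.a] :=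
  fun n => ⟨(semiconj_p1.iterate_right n) [L.A], (semiconj_p2.iterate_right n) [L.A]⟩

end Stmt7
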